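/- Let S be a simplex in ℝⁿ and x ∈ S a point, and let S_x denote the image of S under point reflection at x. Then vol(conv(S ∪ S_x)) ≤ 2ⁿ · vol(S), with equality attained when x is a vertex of S. -/

import Mathlib

open MeasureTheory

namespace SimplexRefl

abbrev E (n : ℕ) := EuclideanSpace ℝ (Fin n)

/-- the corner simplex -/
def T (n : ℕ) : Set (E n) := {c | (∀ i, 0 ≤ c i) ∧ ∑ i, c i ≤ 1}

/-- the cross-polytope -/
def C (n : ℕ) : Set (E n) := {c | ∑ i, |c i| ≤ 1}

lemma mem_hull {n m : ℕ} (v : Fin m → E n) (p : E n) :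
    p ∈ convexHull ℝ (Set.range v) ↔
      ∃ a : Fin m → ℝ, (∀ i, 0 ≤ a i) ∧ ∑ i, a i = 1 ∧ ∑ i, a i • v i = p := by
  constructor
  · intro h
    have : Set.range v = (Fintype.linearCombination ℝ v) ''
        (Set.range fun i j : Fin m => if i = j then (1:ℝ) else 0) := by
      rw [← Set.range_comp]
      congr 1
      ext1 i
      simp [Fintype.linearCombination_apply]
    rw [this, ← LinearMap.image_convexHull, convexHull_basis_eq_stdSimplex] at h
    obtain ⟨a, ha, rfl⟩ := h
    exact ⟨a, ha.1, ha.2, by simp [Fintype.linearCombination_apply]⟩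
  · rintro ⟨a, h0, h1, h2⟩
    exact mem_convexHull_of_exists_fintype a v h0 h1 (fun i => ⟨i, rfl⟩) h2

noncomputable def flip {n : ℕ} (b : Fin n → Bool) : E n ≃ₗᵢ[ℝ] E n :=
  LinearIsometryEquiv.piLpCongrRight 2
    (fun i => if b i then LinearIsometryEquiv.refl ℝ ℝ else LinearIsometryEquiv.neg ℝ)

lemma flip_apply {n : ℕ} (b : Fin n → Bool) (x : E n) (i : Fin n) :
    flip b x i = if b i then x i else - x i := by
  simp only [flip, LinearIsometryEquiv.piLpCongrRight_apply]
  split_ifs <;> simp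

lemma meas_T (n : ℕ) : MeasurableSet (T n) := by
  have : IsClosed (T n) := by
    unfold T
    simp only [Set.ofPred_and, Set.ofPred_forall]
    refine IsClosed.inter (isClosed_iInter fun i => isClosed_le (by fun_prop) (by fun_prop))
      (isClosed_le (by fun_prop) (by fun_prop))
  exact this.measurableSet

lemma meas_C (n : ℕ) : MeasurableSet (C n) := by
  have : IsClosed (C n) := isClosed_le (by fun_prop) (by fun_prop)
  exact this.measurableSet

def O {n : ℕ} (b : Fin n → Bool) : Set (E n) := {x | ∀ i, (0 ≤ x i ↔ b i = true)}

lemma meas_O {n : ℕ} (b : Fin n → Bool) : MeasurableSet (O b) := by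
  unfold O
  rw [Set.ofPred_forall]
  refine MeasurableSet.iInter fun i => ?_
  have h : MeasurableSet {x : E n | 0 ≤ x i} :=
    (isClosed_le (by fun_prop) (by fun_prop)).measurableSet
  cases hb : b i
  · simpa [Set.compl_ofPred] using h.compl
  · simpa using h

lemma ae_ne {n : ℕ} : ∀ᵐ x : E n, ∀ i, x i ≠ 0 := by
  rw [ae_all_iff]
  intro i
  have := Measure.addHaar_submodule (volume : Measure (E n))
    (LinearMap.ker (EuclideanSpace.proj i : E n →L[ℝ] ℝ).toLinearMap) (by
      intro h
      have h1 : EuclideanSpace.single i (1:ℝ) ∈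
        LinearMap.ker (EuclideanSpace.proj i : E n →L[ℝ] ℝ).toLinearMap := by rw [h]; trivial
      simp at h1)
  rw [ae_iff]
  convert this using 2
  ext x
  simp

lemma vol_piece {n : ℕ} (b : Fin n → Bool) : volume (C n ∩ O b) = volume (T n) := by
  rw [← (flip b).measurePreserving.measure_preimage (meas_T n).nullMeasurableSet]
  apply measure_congr
  filter_upwards [ae_ne] with x hx
  apply propext
  change (x ∈ C n ∧ x ∈ O b) ↔ flip b x ∈ T n
  simp only [C, O, T, Set.mem_ofPred_eq, flip_apply]
  constructor
  · rintro ⟨h1, h2⟩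
    have h : ∀ i, (if b i = true then x i else - x i) = |x i| := by
      intro i
      split_ifs with hb
      · rw [abs_of_nonneg ((h2 i).2 hb)]
      · have := (h2 i).not.2 hb
        rw [abs_of_neg (not_le.1 this)]
    simp only [h]
    exact ⟨fun i => abs_nonneg _, h1⟩
  · rintro ⟨h1, h2⟩
    have h : ∀ i, |x i| = (if b i = true then x i else - x i) := by
      intro i
      have := h1 i
      split_ifs at this ⊢ with hb
      · rw [abs_of_nonneg this]
      · rw [abs_of_nonpos (by linarith)]
    simp only [h]
    refine ⟨h2, fun i => ?_⟩
    have h3 := h1 i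
    have h4 := hx i
    split_ifs at h3 with hb
    · simp [hb, h3]
    · simp only [hb]
      simp only [iff_false, not_le, Bool.false_eq_true]
      exact lt_of_le_of_ne (by linarith) h4

lemma vol_C (n : ℕ) : volume (C n) = 2 ^ n * volume (T n) := by
  have h : C n = ⋃ b : Fin n → Bool, C n ∩ O b := by
    ext x
    simp only [Set.mem_iUnion, Set.mem_inter_iff, exists_and_left]
    refine ⟨fun hx => ⟨hx, fun i => decide (0 ≤ x i), fun i => by simp⟩, fun hx => hx.1⟩
  rw [h, measure_iUnion]
  · simp [vol_piece, tsum_fintype]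
  · intro b b' hbb
    refine Set.disjoint_left.2 fun x hx hx' => hbb ?_
    ext i
    have h1 := hx.2 i
    have h2 := hx'.2 i
    rw [Bool.eq_iff_iff, ← h1, ← h2]
  · exact fun b => (meas_C n).inter (meas_O b)

/-- linear map `c ↦ ∑ c_i u_i` -/
noncomputable def M {n : ℕ} (u : Fin n → E n) : E n →ₗ[ℝ] E n :=
  (Fintype.linearCombination ℝ u) ∘ₗ (WithLp.linearEquiv 2 ℝ (Fin n → ℝ)).toLinearMap

lemma M_apply {n : ℕ} (u : Fin n → E n) (c : E n) : M u c = ∑ i, c i • u i := by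
  simp [M, Fintype.linearCombination_apply]

lemma hull_eq {n : ℕ} (v : Fin (n + 1) → E n) (j : Fin (n + 1)) :
    convexHull ℝ (Set.range v) =
      (fun p => v j + p) '' (M (fun k => v (j.succAbove k) - v j) '' T n) := by
  ext p
  rw [mem_hull]
  simp only [Set.mem_image, exists_exists_and_eq_and, M_apply]
  constructor
  · rintro ⟨a, h0, h1, rfl⟩
    rw [Fin.sum_univ_succAbove _ j] at h1
    refine ⟨WithLp.toLp 2 fun k => a (j.succAbove k), ⟨fun i => h0 _, ?_⟩, ?_⟩
    · have := h0 j
      simp only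
      linarith
    · rw [Fin.sum_univ_succAbove _ j, eq_sub_of_add_eq h1]
      simp only [smul_sub, Finset.sum_sub_distrib, ← Finset.sum_smul, sub_smul, one_smul]
      abel
  · rintro ⟨c, ⟨h0, h1⟩, rfl⟩
    refine ⟨j.insertNth (1 - ∑ i, c i) c, ?_, ?_, ?_⟩
    · intro i
      refine Fin.succAboveCases j ?_ (fun k => ?_) i
      · simpa using h1
      · simpa using h0 k
    · simp [Fin.sum_univ_succAbove _ j]
    · simp only [Fin.sum_univ_succAbove _ j, Fin.insertNth_apply_same,
        Fin.insertNth_apply_succAbove]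
      simp only [smul_sub, Finset.sum_sub_distrib, ← Finset.sum_smul, sub_smul, one_smul]
      abel

lemma vol_hull {n : ℕ} (v : Fin (n + 1) → E n) (j : Fin (n + 1)) :
    volume (convexHull ℝ (Set.range v)) =
      ENNReal.ofReal |LinearMap.det (M (fun k => v (j.succAbove k) - v j))| * volume (T n) := by
  rw [hull_eq v j, Set.image_add_left, measure_preimage_add, Measure.addHaar_image_linearMap]

lemma det_rel {n : ℕ} (v : Fin (n + 1) → E n) (l : Fin (n + 1) → ℝ) (hl : ∑ i, l i = 1)
    (j : Fin (n + 1)) (x : E n) (hx : ∑ i, l i • v i = x) :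
    LinearMap.det (M (fun k => v (j.succAbove k) - x)) =
      LinearMap.det (M (fun k => v (j.succAbove k) - v j)) * l j := by
  let f : Module.Dual ℝ (E n) := ∑ i, (EuclideanSpace.proj i : E n →L[ℝ] ℝ).toLinearMap
  let y : E n := WithLp.toLp 2 fun k => - l (j.succAbove k)
  rw [Fin.sum_univ_succAbove _ j] at hl hx
  have hf : ∀ c : E n, f c = ∑ i, c i := fun c => by simp [f]
  have h : M (fun k => v (j.succAbove k) - x) =
      M (fun k => v (j.succAbove k) - v j) ∘ₗ LinearMap.transvection f y := by
    ext1 c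
    rw [LinearMap.comp_apply, LinearMap.transvection.apply, map_add, map_smul, hf]
    have hy : M (fun k => v (j.succAbove k) - v j) y = v j - x := by
      simp only [M_apply, y]
      rw [← hx, eq_sub_of_add_eq hl]
      simp only [smul_sub, Finset.sum_sub_distrib, ← Finset.sum_smul, sub_smul, one_smul,
        neg_smul, Finset.sum_neg_distrib]
      abel
    rw [hy]
    simp only [M_apply]
    simp only [smul_sub, Finset.sum_sub_distrib, ← Finset.sum_smul]
    abel
  rw [h, LinearMap.det_comp, LinearMap.transvection.det, hf]
  congr 1
  simp only [y, Finset.sum_neg_distrib]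
  linarith

lemma vol_cross {n : ℕ} (v : Fin (n + 1) → E n) (l : Fin (n + 1) → ℝ) (hl : ∑ i, l i = 1)
    (hl0 : ∀ i, 0 ≤ l i)
    (j : Fin (n + 1)) (x : E n) (hx : ∑ i, l i • v i = x) :
    volume ((fun p => x + p) '' (M (fun k => v (j.succAbove k) - x) '' C n)) =
      ENNReal.ofReal (l j) * (2 ^ n * volume (convexHull ℝ (Set.range v))) := by
  rw [Set.image_add_left, measure_preimage_add, Measure.addHaar_image_linearMap, vol_C,
    det_rel v l hl j x hx, abs_mul, vol_hull v j, abs_of_nonneg (hl0 j),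
    ENNReal.ofReal_mul (abs_nonneg _)]
  ring

lemma shift_aux {m : ℕ} (c l : Fin m → ℝ) (hl0 : ∀ i, 0 ≤ l i) (hl : ∑ i, l i = 1)
    (hs : ∑ i, (if 0 ≤ c i then l i else - l i) ≤ 0) :
    ∃ t : ℝ, ∃ j, c j + t * l j = 0 ∧ ∑ i, |c i + t * l i| ≤ ∑ i, |c i| := by
  classical
  let N : Finset (Fin m) := Finset.univ.filter fun i => c i < 0 ∧ 0 < l i
  have hN : N.Nonempty := by
    by_contra h
    rw [Finset.not_nonempty_iff_eq_empty] at h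
    have : ∑ i, (if 0 ≤ c i then l i else - l i) = ∑ i, l i := by
      refine Finset.sum_congr rfl fun i _ => ?_
      split_ifs with hc
      · rfl
      · have hi : i ∉ N := by rw [h]; simp
        simp only [N, Finset.mem_filter, Finset.mem_univ, true_and, not_and, not_lt] at hi
        have := hi (not_le.1 hc)
        have := hl0 i
        linarith
    linarith
  obtain ⟨j, hj, hmin⟩ := N.exists_min_image (fun i => - c i / l i) hN
  simp only [N, Finset.mem_filter, Finset.mem_univ, true_and] at hj hmin
  have ht : 0 ≤ - c j / l j := div_nonneg (by linarith) hj.2.le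
  refine ⟨- c j / l j, j, ?_, ?_⟩
  · field_simp [hj.2.ne']
    ring
  · generalize - c j / l j = t at *
    have h : ∀ i, |c i + t * l i| = |c i| + t * (if 0 ≤ c i then l i else - l i) := by
      intro i
      have h1 := mul_nonneg ht (hl0 i)
      split_ifs with hc
      · rw [abs_of_nonneg hc, abs_of_nonneg (by linarith)]
      · push Not at hc
        have : t * l i ≤ - c i := by
          rcases (hl0 i).eq_or_lt with h0 | h0
          · rw [← h0]; linarith
          · exact (le_div_iff₀ h0).1 (hmin i ⟨hc, h0⟩)
        rw [abs_of_neg hc, abs_of_nonpos (by linarith)]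
        ring
    simp only [h, Finset.sum_add_distrib, ← Finset.mul_sum]
    nlinarith

lemma shift {m : ℕ} (c l : Fin m → ℝ) (hl0 : ∀ i, 0 ≤ l i) (hl : ∑ i, l i = 1) :
    ∃ t : ℝ, ∃ j, c j + t * l j = 0 ∧ ∑ i, |c i + t * l i| ≤ ∑ i, |c i| := by
  by_cases h0 : ∃ j, c j = 0
  · obtain ⟨j, hj⟩ := h0
    exact ⟨0, j, by simp [hj], by simp⟩
  push Not at h0
  by_cases hs : ∑ i, (if 0 ≤ c i then l i else - l i) ≤ 0
  · exact shift_aux c l hl0 hl hs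
  · obtain ⟨t, j, h1, h2⟩ := shift_aux (fun i => - c i) l hl0 hl (by
      have : ∑ i, (if 0 ≤ - c i then l i else - l i) =
          - ∑ i, (if 0 ≤ c i then l i else - l i) := by
        rw [← Finset.sum_neg_distrib]
        refine Finset.sum_congr rfl fun i _ => ?_
        rcases lt_or_gt_of_ne (h0 i) with h | h
        · rw [if_pos (by linarith), if_neg (by linarith)]; ring
        · rw [if_neg (by linarith), if_pos (by linarith)]
      rw [this]
      linarith)
    refine ⟨-t, j, by linarith, ?_⟩
    have h3 : ∀ i, |c i + -t * l i| = |-c i + t * l i| := fun i => by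
      rw [← abs_neg]; congr 1; ring
    simp only [h3]
    simpa only [abs_neg] using h2

/-- description of the big hull as an image of an `(n+1)`-dimensional cross-polytope -/
def D {n : ℕ} (v : Fin (n + 1) → E n) (x : E n) : Set (E n) :=
  {p | ∃ c : Fin (n + 1) → ℝ, ∑ i, |c i| ≤ 1 ∧ x + ∑ i, c i • (v i - x) = p}

lemma convex_D {n : ℕ} (v : Fin (n + 1) → E n) (x : E n) : Convex ℝ (D v x) := by
  rintro _ ⟨c, hc, rfl⟩ _ ⟨d, hd, rfl⟩ a b ha hb hab
  refine ⟨fun i => a * c i + b * d i, ?_, ?_⟩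
  · calc ∑ i, |a * c i + b * d i| ≤ ∑ i, (a * |c i| + b * |d i|) := by
          refine Finset.sum_le_sum fun i _ => (abs_add_le _ _).trans ?_
          rw [abs_mul, abs_mul, abs_of_nonneg ha, abs_of_nonneg hb]
      _ = a * ∑ i, |c i| + b * ∑ i, |d i| := by
          rw [Finset.sum_add_distrib, Finset.mul_sum, Finset.mul_sum]
      _ ≤ 1 := by nlinarith
  · simp only [add_smul, Finset.sum_add_distrib, mul_smul, ← Finset.smul_sum]
    rw [eq_sub_of_add_eq hab]
    module

lemma hull_subset_D {n : ℕ} (v : Fin (n + 1) → E n) (x : E n) :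
    convexHull ℝ (convexHull ℝ (Set.range v) ∪
        (fun p => (2 : ℝ) • x - p) '' convexHull ℝ (Set.range v)) ⊆ D v x := by
  refine convexHull_min ?_ (convex_D v x)
  rintro p (hp | ⟨p, hp, rfl⟩)
  · obtain ⟨a, h0, h1, rfl⟩ := (mem_hull v p).1 hp
    refine ⟨a, by simp [abs_of_nonneg (h0 _), h1], ?_⟩
    simp only [smul_sub, Finset.sum_sub_distrib, ← Finset.sum_smul, h1]
    module
  · obtain ⟨a, h0, h1, rfl⟩ := (mem_hull v p).1 hp
    refine ⟨fun i => - a i, by simp [abs_of_nonneg (h0 _), h1], ?_⟩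
    simp only [smul_sub, Finset.sum_sub_distrib, ← Finset.sum_smul, h1, neg_smul,
      Finset.sum_neg_distrib]
    module

lemma D_subset_hull {n : ℕ} (v : Fin (n + 1) → E n) (x : E n)
    (hx : x ∈ convexHull ℝ (Set.range v)) :
    D v x ⊆ convexHull ℝ (convexHull ℝ (Set.range v) ∪
        (fun p => (2 : ℝ) • x - p) '' convexHull ℝ (Set.range v)) := by
  rintro _ ⟨c, hc, rfl⟩
  refine mem_convexHull_of_exists_fintype (ι := Option (Fin (n + 1)))
    (fun o => o.elim (1 - ∑ i, |c i|) (fun i => |c i|))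
    (fun o => o.elim x (fun i => if 0 ≤ c i then v i else (2:ℝ) • x - v i)) ?_ ?_ ?_ ?_
  · rintro (_ | i)
    · simpa using hc
    · simp
  · simp [Fintype.sum_option]
  · rintro (_ | i)
    · exact Or.inl hx
    · have hi : v i ∈ convexHull ℝ (Set.range v) := subset_convexHull _ _ ⟨i, rfl⟩
      simp only [Option.elim]
      split_ifs
      · exact Or.inl hi
      · exact Or.inr ⟨_, hi, rfl⟩
  · simp only [Fintype.sum_option, Option.elim]
    have h : ∀ i, |c i| • (if 0 ≤ c i then v i else (2:ℝ) • x - v i) =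
        |c i| • x + c i • (v i - x) := by
      intro i
      split_ifs with h
      · rw [abs_of_nonneg h]; module
      · rw [abs_of_neg (not_le.1 h)]; module
    simp only [h, Finset.sum_add_distrib, ← Finset.sum_smul]
    module

lemma D_subset {n : ℕ} (v : Fin (n + 1) → E n) (l : Fin (n + 1) → ℝ) (hl : ∑ i, l i = 1)
    (hl0 : ∀ i, 0 ≤ l i) (x : E n) (hx : ∑ i, l i • v i = x) :
    D v x ⊆ ⋃ j : Fin (n + 1), (fun p => x + p) '' (M (fun k => v (j.succAbove k) - x) '' C n) := by
  rintro _ ⟨c, hc, rfl⟩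
  obtain ⟨t, j, hj, hle⟩ := shift c l hl0 hl
  have h0 : ∑ i, l i • (v i - x) = 0 := by
    simp only [smul_sub, Finset.sum_sub_distrib, ← Finset.sum_smul, hl, hx, one_smul, sub_self]
  have h1 : ∑ i, c i • (v i - x) = ∑ i, (c i + t * l i) • (v i - x) := by
    simp only [add_smul, Finset.sum_add_distrib, mul_smul, ← Finset.smul_sum, h0, smul_zero,
      add_zero]
  refine Set.mem_iUnion.2 ⟨j, _, ⟨WithLp.toLp 2 fun k =>
    c (j.succAbove k) + t * l (j.succAbove k), ?_, rfl⟩, ?_⟩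
  · have := hle.trans hc
    rw [Fin.sum_univ_succAbove _ j, hj, abs_zero, zero_add] at this
    exact this
  · simp only [M_apply]
    rw [h1, Fin.sum_univ_succAbove _ j, hj, zero_smul, zero_add]

lemma subset_D {n : ℕ} (v : Fin (n + 1) → E n) (x : E n) (j : Fin (n + 1)) :
    (fun p => x + p) '' (M (fun k => v (j.succAbove k) - x) '' C n) ⊆ D v x := by
  rintro _ ⟨_, ⟨c, hc, rfl⟩, rfl⟩
  have hc' : ∑ i, |c i| ≤ 1 := hc
  refine ⟨j.insertNth 0 c, ?_, ?_⟩
  · simpa [Fin.sum_univ_succAbove _ j] using hc'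
  · simp [Fin.sum_univ_succAbove _ j, M_apply]

lemma main_le {n : ℕ} (v : Fin (n + 1) → E n) (x : E n)
    (hx : x ∈ convexHull ℝ (Set.range v)) :
    volume (convexHull ℝ (convexHull ℝ (Set.range v) ∪
        (fun p => (2 : ℝ) • x - p) '' convexHull ℝ (Set.range v)))
      ≤ 2 ^ n * volume (convexHull ℝ (Set.range v)) := by
  obtain ⟨l, hl0, hl, hx'⟩ := (mem_hull v x).1 hx
  refine (measure_mono ((hull_subset_D v x).trans (D_subset v l hl hl0 x hx'))).trans ?_
  refine (measure_iUnion_fintype_le _ _).trans ?_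
  simp only [vol_cross v l hl hl0 _ x hx']
  rw [← Finset.sum_mul, ← ENNReal.ofReal_sum_of_nonneg (fun i _ => hl0 i), hl]
  simp

end SimplexRefl

/-- For an `n`-simplex `S` and `x ∈ S`, the volume of the convex hull of `S` and
its point-reflected image `S_x = {2x - p : p ∈ S}` is at most `2ⁿ · vol(S)`, with equality
attained when `x` is a vertex of `S`. -/
theorem volume_convexHull_point_reflection_le {n : ℕ}
    (v : Fin (n + 1) → EuclideanSpace ℝ (Fin n)) (hv : AffineIndependent ℝ v)
    (x : EuclideanSpace ℝ (Fin n)) (hx : x ∈ convexHull ℝ (Set.range v)) :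
    volume (convexHull ℝ (convexHull ℝ (Set.range v) ∪
        (fun p => (2 : ℝ) • x - p) '' convexHull ℝ (Set.range v)))
      ≤ 2 ^ n * volume (convexHull ℝ (Set.range v)) ∧
    (x ∈ Set.range v →
      volume (convexHull ℝ (convexHull ℝ (Set.range v) ∪
          (fun p => (2 : ℝ) • x - p) '' convexHull ℝ (Set.range v)))
        = 2 ^ n * volume (convexHull ℝ (Set.range v))) := by
  refine ⟨SimplexRefl.main_le v x hx, ?_⟩
  rintro ⟨j, rfl⟩
  refine le_antisymm (SimplexRefl.main_le v _ hx) ?_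
  have h := SimplexRefl.vol_cross v (Pi.single j 1) (by simp)
    (fun i => by by_cases h : i = j <;> simp [Pi.single_apply, h]) j (v j)
    (by simp [Pi.single_apply])
  rw [Pi.single_eq_same, ENNReal.ofReal_one, one_mul] at h
  rw [← h]
  exact measure_mono ((SimplexRefl.subset_D v (v j) j).trans
    (SimplexRefl.D_subset_hull v (v j) hx))
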